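/- Let α ∈ (0,1/2) and let μ be a Borel probability measure on ℝ with finite second moment admitting a continuous density, with VaR_α(μ) < 0, and let W be a constant with ES_α(μ)/VaR_α(μ) ≥ W ≥ 1. Then the Hessian of the expected Acerbi–Székely score s_α(v,e) is positive semi-definite at every point of the region B = {(v,e) ∈ ℝ² : v ≤ VaR_α(μ) and W·v ≤ e ≤ v ≤ 0}. -/

import Mathlib

open MeasureTheory Set

/-- Value-at-Risk at level `α`. -/
noncomputable def VaR (α : ℝ) (μ : Measure ℝ) : ℝ :=
  sInf {x : ℝ | α ≤ (μ (Iic x)).toReal}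

/-- Expected Shortfall at level `α`. -/
noncomputable def ES (α : ℝ) (μ : Measure ℝ) : ℝ :=
  (1 / α) * ∫ b in (0:ℝ)..α, VaR b μ

/-- The Acerbi–Székely score function with weight `W`. -/
noncomputable def ASscore (α W v e x : ℝ) : ℝ :=
  (W / 2) * ((if x ≤ v then (1:ℝ) else 0) - α) * (x ^ 2 - v ^ 2)
    + (if x ≤ v then (1:ℝ) else 0) * e * (v - x) + α * e * (e / 2 - v)

/-- The expected Acerbi–Székely score `s_α(v, e) = ∫ S_α(v,e,x) μ(dx)`. -/
noncomputable def expScore (α W : ℝ) (μ : Measure ℝ) (v e : ℝ) : ℝ :=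
  ∫ x, ASscore α W v e x ∂μ

/-- Second partial derivative of the expected score in `v`. -/
noncomputable def s_vv (α W : ℝ) (μ : Measure ℝ) (v e : ℝ) : ℝ :=
  deriv (fun t => deriv (fun u => expScore α W μ u e) t) v

/-- Second partial derivative of the expected score in `e`. -/
noncomputable def s_ee (α W : ℝ) (μ : Measure ℝ) (v e : ℝ) : ℝ :=
  deriv (fun t => deriv (fun u => expScore α W μ v u) t) e

/-- Mixed second partial derivative of the expected score. -/
noncomputable def s_ve (α W : ℝ) (μ : Measure ℝ) (v e : ℝ) : ℝ :=
  deriv (fun e' => deriv (fun v' => expScore α W μ v' e') v) e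

/-- The density of a withDensity measure is the derivative of its partial integrals. -/
theorem hasDerivAt_setIntegral_Iic_withDensity {f φ : ℝ → ℝ} (hf : Continuous f)
    (hφ : Continuous φ)
    (hint : Integrable φ (volume.withDensity fun x => ENNReal.ofReal (f x))) (v : ℝ) :
    HasDerivAt (fun t => ∫ x in Iic t, φ x ∂(volume.withDensity fun x => ENNReal.ofReal (f x)))
      (max (f v) 0 * φ v) v := by
  have hcont : Continuous fun x => max (f x) 0 * φ x := by fun_prop
  have hmeas : Measurable fun x => (f x).toNNReal := hf.measurable.real_toNNReal
  have hvol : Integrable fun x => max (f x) 0 * φ x :=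
    (integrable_withDensity_iff_integrable_smul hmeas).1 hint
  have heq : ∀ t, ∫ x in Iic t, φ x ∂(volume.withDensity fun x => ENNReal.ofReal (f x))
      = (∫ x in Iic 0, max (f x) 0 * φ x) + ∫ x in (0:ℝ)..t, max (f x) 0 * φ x := by
    intro t
    rw [← intervalIntegral.integral_Iic_sub_Iic hvol.integrableOn hvol.integrableOn]
    have h := setIntegral_withDensity_eq_setIntegral_smul (μ := volume) hmeas φ
      (measurableSet_Iic (a := t))
    rw [add_sub_cancel]
    exact h
  simp_rw [heq]
  exact (intervalIntegral.integral_hasDerivAt_right (hcont.intervalIntegrable _ _)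
    (hcont.stronglyMeasurableAtFilter _ _) hcont.continuousAt).const_add _

/-- The expected score in terms of the partial moments of `μ`. -/
theorem expScore_eq (α W : ℝ) (μ : Measure ℝ) [IsProbabilityMeasure μ]
    (h1 : Integrable (fun x : ℝ => x) μ) (h2 : Integrable (fun x : ℝ => x ^ 2) μ) (v e : ℝ) :
    expScore α W μ v e =
      W / 2 * ((∫ x in Iic v, x ^ 2 ∂μ) - v ^ 2 * ∫ _ in Iic v, (1:ℝ) ∂μ)
        - α * W / 2 * ((∫ x, x ^ 2 ∂μ) - v ^ 2)
        + e * (v * (∫ _ in Iic v, (1:ℝ) ∂μ) - ∫ x in Iic v, x ∂μ)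
        + α * e * (e / 2 - v) := by
  have hpt : ∀ x, ASscore α W v e x =
      (Iic v).indicator (fun x => W / 2 * x ^ 2) x
        + (Iic v).indicator (fun _ => (e * v - W / 2 * v ^ 2) * 1) x
        + (Iic v).indicator (fun x => -e * x) x
        + (-(α * W / 2)) * x ^ 2 + (α * W / 2 * v ^ 2 + α * e * (e / 2 - v)) := by
    intro x
    by_cases hx : x ≤ v <;> simp [ASscore, indicator, hx] <;> ring
  have i2 := (h2.const_mul (W / 2)).indicator (measurableSet_Iic (a := v))
  have i0 := ((integrable_const (1:ℝ) (μ := μ)).const_mul (e * v - W / 2 * v ^ 2)).indicator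
    (measurableSet_Iic (a := v))
  have i1 := (h1.const_mul (-e)).indicator (measurableSet_Iic (a := v))
  have j2 := h2.const_mul (-(α * W / 2))
  have k1 := i2.add i0
  have k2 := k1.add i1
  have k3 := k2.add j2
  unfold expScore
  simp_rw [hpt]
  erw [integral_add k3 (integrable_const _), integral_add k2 j2, integral_add k1 i1,
    integral_add i2 i0]
  simp only [integral_indicator measurableSet_Iic, integral_const_mul,
    integral_const_mul (-e) fun x : ℝ => x, integral_const,
    probReal_univ, one_smul]
  ring

theorem hasDerivAt_expScore_left (α W : ℝ) {f : ℝ → ℝ} (hf : Continuous f)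
    (μ : Measure ℝ) [IsProbabilityMeasure μ]
    (hdens : μ = volume.withDensity (fun x => ENNReal.ofReal (f x)))
    (h1 : Integrable (fun x : ℝ => x) μ) (h2 : Integrable (fun x : ℝ => x ^ 2) μ) (v e : ℝ) :
    HasDerivAt (fun u => expScore α W μ u e)
      (((∫ _ in Iic v, (1:ℝ) ∂μ) - α) * (e - W * v)) v := by
  simp_rw [expScore_eq α W μ h1 h2]
  have d0 : HasDerivAt (fun t => ∫ _ in Iic t, (1:ℝ) ∂μ) (max (f v) 0 * 1) v := by
    have h0 := integrable_const (1:ℝ) (μ := μ)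
    rw [hdens] at h0 ⊢
    exact hasDerivAt_setIntegral_Iic_withDensity hf continuous_const h0 v
  have d1 : HasDerivAt (fun t => ∫ x in Iic t, x ∂μ) (max (f v) 0 * v) v := by
    rw [hdens] at h1 ⊢
    exact hasDerivAt_setIntegral_Iic_withDensity hf continuous_id h1 v
  have d2 : HasDerivAt (fun t => ∫ x in Iic t, x ^ 2 ∂μ) (max (f v) 0 * v ^ 2) v := by
    rw [hdens] at h2 ⊢
    exact hasDerivAt_setIntegral_Iic_withDensity hf (continuous_id.pow 2) h2 v
  have dv := hasDerivAt_id' v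
  have dvv := hasDerivAt_pow 2 v
  refine ((((d2.sub (dvv.mul d0)).const_mul (W / 2)).sub
    ((dvv.const_sub (∫ x, x ^ 2 ∂μ)).const_mul (α * W / 2))).add
    (((dv.mul d0).sub d1).const_mul e) |>.add
    ((dv.const_sub (e / 2)).const_mul (α * e))).congr_deriv ?_
  push_cast
  ring

theorem hasDerivAt_expScore_right (α W : ℝ) (μ : Measure ℝ) [IsProbabilityMeasure μ]
    (h1 : Integrable (fun x : ℝ => x) μ) (h2 : Integrable (fun x : ℝ => x ^ 2) μ) (v e : ℝ) :
    HasDerivAt (fun u => expScore α W μ v u)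
      (v * (∫ _ in Iic v, (1:ℝ) ∂μ) - (∫ x in Iic v, x ∂μ) + α * (e - v)) e := by
  simp_rw [expScore_eq α W μ h1 h2]
  have de := hasDerivAt_id' e
  refine (((de.mul_const _).const_add _).add
    ((de.const_mul α).mul ((de.div_const 2).sub_const v))).congr_deriv ?_
  ring

/-- A negative Value-at-Risk is a point below which the distribution function stays at most
`α`, provided the distribution function is continuous. -/
theorem cdf_le_of_le_VaR {α : ℝ} {μ : Measure ℝ} {F : ℝ → ℝ}
    (hF : ∀ x, F x = (μ (Iic x)).toReal) (hcont : Continuous F) (hneg : VaR α μ < 0)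
    {v : ℝ} (hv : v ≤ VaR α μ) : F v ≤ α := by
  have hbdd : BddBelow {x : ℝ | α ≤ (μ (Iic x)).toReal} := by
    by_contra h
    exact hneg.ne (Real.sInf_of_not_bddBelow h)
  have hlt : ∀ x ∈ Iio v, F x ≤ α := by
    intro x hx
    by_contra! h
    have : VaR α μ ≤ x := csInf_le hbdd (by simpa [← hF] using h.le)
    exact absurd (hv.trans this) (not_le.2 hx)
  have hcl : v ∈ closure (Iio v) := by rw [closure_Iio]; exact self_mem_Iic
  exact closure_minimal hlt (isClosed_le hcont continuous_const) hcl

/-- The Hessian of the expected Acerbi–Székely score is positive semi-definite on the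
region `B = {(v,e) : v ≤ VaR_α(μ), W v ≤ e ≤ v ≤ 0}`. -/
theorem hessian_posSemidef_on_B
    (α W : ℝ) (hα : α ∈ Ioo (0:ℝ) (1/2))
    (f : ℝ → ℝ) (hf : Continuous f)
    (μ : Measure ℝ) [IsProbabilityMeasure μ]
    (hdens : μ = volume.withDensity (fun x => ENNReal.ofReal (f x)))
    (hmom : Integrable (fun x => x ^ 2) μ)
    (hVaRneg : VaR α μ < 0)
    (hW : 1 ≤ W) (hWle : W ≤ ES α μ / VaR α μ) :
    ∀ v e : ℝ, v ≤ VaR α μ → W * v ≤ e → e ≤ v → v ≤ 0 →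
      ∀ a b : ℝ,
        0 ≤ s_vv α W μ v e * a ^ 2 + 2 * s_ve α W μ v e * a * b
              + s_ee α W μ v e * b ^ 2 := by
  intro v e hv hWe hev hv0 a b
  have h1 : Integrable (fun x : ℝ => x) μ :=
    ((memLp_two_iff_integrable_sq measurable_id.aestronglyMeasurable).2 hmom).integrable
      one_le_two
  set F : ℝ → ℝ := fun t => ∫ _ in Iic t, (1:ℝ) ∂μ with hFdef
  have hF : ∀ x, F x = (μ (Iic x)).toReal := fun x => by simp [F, Measure.real]
  have dF : ∀ t, HasDerivAt F (max (f t) 0) t := by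
    intro t
    have h0 := integrable_const (1:ℝ) (μ := μ)
    simp only [hFdef]
    rw [hdens] at h0 ⊢
    simpa using hasDerivAt_setIntegral_Iic_withDensity hf continuous_const h0 t
  have hFc : Continuous F := continuous_iff_continuousAt.2 fun t => (dF t).continuousAt
  have hFα : F v ≤ α := cdf_le_of_le_VaR hF hFc hVaRneg hv
  have hF0 : 0 ≤ F v := by rw [hF]; exact ENNReal.toReal_nonneg
  have dl : ∀ t u, deriv (fun s => expScore α W μ s u) t = (F t - α) * (u - W * t) :=
    fun t u => (hasDerivAt_expScore_left α W hf μ hdens h1 hmom t u).deriv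
  have dr := fun t u => (hasDerivAt_expScore_right α W μ h1 hmom t u).deriv
  have hvv : s_vv α W μ v e = max (f v) 0 * (e - W * v) + W * (α - F v) := by
    unfold s_vv
    simp_rw [dl]
    refine ((((dF v).sub_const α).mul
      (((hasDerivAt_id' v).const_mul W).const_sub e)).congr_deriv ?_).deriv
    ring
  have hve : s_ve α W μ v e = F v - α := by
    unfold s_ve
    simp_rw [dl]
    refine ((((hasDerivAt_id' e).sub_const (W * v)).const_mul (F v - α)).congr_deriv ?_).deriv
    ring
  have hee : s_ee α W μ v e = α := by
    unfold s_ee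
    simp_rw [dr]
    refine (((((hasDerivAt_id' e).sub_const v).const_mul α).const_add _).congr_deriv ?_).deriv
    ring
  rw [hvv, hve, hee]
  have hd : 0 ≤ max (f v) 0 * (e - W * v) :=
    mul_nonneg (le_max_right _ _) (sub_nonneg.2 hWe)
  have p1 := mul_nonneg hd (sq_nonneg a)
  have p2 := mul_nonneg (mul_nonneg (sub_nonneg.2 hW) (sub_nonneg.2 hFα)) (sq_nonneg a)
  have p3 := mul_nonneg (sub_nonneg.2 hFα) (sq_nonneg (a - b))
  have p4 := mul_nonneg hF0 (sq_nonneg b)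
  linarith
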